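/- arXiv:2109.09663 — 3 statements merged into one kernel-verified Lean document; each statement's English description precedes it below -/
import Mathlib

section
/- Let G be a finite simple graph on n vertices whose vertex set carries a linear order, edges oriented from smaller to larger endpoint, and let c ≥ 2. Then Σ_{e ∈ RE(G,c)} |RE(G[C(e)], c−2)| ≤ Σ_{e ∈ RE(G,c)} |RP(C(e), c−2)|, and moreover 4 · Σ_{e ∈ RE(G,c)} |RP(C(e), c−2)| ≤ (n−c)² · |RE(G,c)|. -/
open scoped Classical

/-- All but at most `c` elements of `J` have at least `c` elements of `J` below them. -/
lemma card_le_card_filter_le_card_below {V : Type*} [LinearOrder V] (J : Finset V) (c : ℕ) :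
    J.card ≤ (J.filter fun w => c ≤ (J.filter fun a => a < w).card).card + c := by
  rw [← Finset.card_filter_add_card_filter_not
    (s := J) (fun w => c ≤ (J.filter fun a => a < w).card)]
  refine Nat.add_le_add_left ?_ _
  rcases (J.filter fun w => ¬ c ≤ (J.filter fun a => a < w).card).eq_empty_or_nonempty with h | h
  · rw [h, Finset.card_empty]
    exact Nat.zero_le _
  · obtain ⟨w, hw, hmax⟩ := Finset.exists_max_image _ id h
    have hsub : (J.filter fun w => ¬ c ≤ (J.filter fun a => a < w).card) ⊆
        insert w (J.filter fun a => a < w) := by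
      intro x hx
      rcases (hmax x hx).eq_or_lt with h1 | h1
      · exact Finset.mem_insert.2 (Or.inl h1)
      · exact Finset.mem_insert_of_mem (Finset.mem_filter.2 ⟨(Finset.mem_filter.1 hx).1, h1⟩)
    have h1 := Finset.card_le_card hsub
    have h2 := Finset.card_insert_le w (J.filter fun a => a < w)
    have h3 := (Finset.mem_filter.1 hw).2
    omega

/-- All but at most `c` elements of `J` have at least `c` elements of `J` above them. -/
lemma card_le_card_filter_le_card_above {V : Type*} [LinearOrder V] (J : Finset V) (c : ℕ) :
    J.card ≤ (J.filter fun w => c ≤ (J.filter fun a => w < a).card).card + c := by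
  rw [← Finset.card_filter_add_card_filter_not
    (s := J) (fun w => c ≤ (J.filter fun a => w < a).card)]
  refine Nat.add_le_add_left ?_ _
  rcases (J.filter fun w => ¬ c ≤ (J.filter fun a => w < a).card).eq_empty_or_nonempty with h | h
  · rw [h, Finset.card_empty]
    exact Nat.zero_le _
  · obtain ⟨w, hw, hmin⟩ := Finset.exists_min_image _ id h
    have hsub : (J.filter fun w => ¬ c ≤ (J.filter fun a => w < a).card) ⊆
        insert w (J.filter fun a => w < a) := by
      intro x hx
      rcases (hmin x hx).eq_or_lt with h1 | h1
      · exact Finset.mem_insert.2 (Or.inl h1.symm)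
      · exact Finset.mem_insert_of_mem (Finset.mem_filter.2 ⟨(Finset.mem_filter.1 hx).1, h1⟩)
    have h1 := Finset.card_le_card hsub
    have h2 := Finset.card_insert_le w (J.filter fun a => w < a)
    have h3 := (Finset.mem_filter.1 hw).2
    omega

/-- At most `#J - d` elements of `J` have at least `d` elements of `J` above them. -/
lemma card_filter_le_card_above_le {V : Type*} [LinearOrder V] (J : Finset V) (d : ℕ) :
    (J.filter fun w => d ≤ (J.filter fun a => w < a).card).card ≤ J.card - d := by
  rcases (J.filter fun w => d ≤ (J.filter fun a => w < a).card).eq_empty_or_nonempty with h | h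
  · simp [h]
  · obtain ⟨w, hw, hmax⟩ := Finset.exists_max_image _ id h
    have hdisj : Disjoint (J.filter fun w => d ≤ (J.filter fun a => w < a).card)
        (J.filter fun a => w < a) :=
      Finset.disjoint_left.2 fun x hx hx' =>
        absurd (hmax x hx) (not_le.2 (Finset.mem_filter.1 hx').2)
    have h1 := Finset.card_le_card (Finset.union_subset
      (Finset.filter_subset (fun w => d ≤ (J.filter fun a => w < a).card) J)
      (Finset.filter_subset (fun a => w < a) J))
    rw [Finset.card_union_of_disjoint hdisj] at h1
    have h3 := (Finset.mem_filter.1 hw).2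
    omega

/-- A set of size `m` has at most `(m - d).choose 2` pairs with at least `d` elements between. -/
lemma card_relevant_pairs_le {V : Type*} [LinearOrder V] (I : Finset V) (d : ℕ) :
    ((I ×ˢ I).filter fun p : V × V =>
      p.1 < p.2 ∧ d ≤ (I.filter fun w => p.1 < w ∧ w < p.2).card).card ≤
        (I.card - d).choose 2 := by
  induction I using Finset.induction_on_max with
  | empty => simp
  | insert b J hb ih =>
    have hbJ : b ∉ J := fun h => lt_irrefl b (hb b h)
    have hsub : ((insert b J ×ˢ insert b J).filter fun p : V × V =>
        p.1 < p.2 ∧ d ≤ ((insert b J).filter fun w => p.1 < w ∧ w < p.2).card) ⊆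
        ((J ×ˢ J).filter fun p : V × V =>
          p.1 < p.2 ∧ d ≤ (J.filter fun w => p.1 < w ∧ w < p.2).card) ∪
        (J.filter fun w => d ≤ (J.filter fun a => w < a).card).image fun a => (a, b) := by
      rintro ⟨x, y⟩ h
      simp only [Finset.mem_filter, Finset.mem_product, Finset.mem_insert] at h
      obtain ⟨⟨hx, hy⟩, hxy, hd⟩ := h
      have hxJ : x ∈ J := by
        rcases hx with rfl | hx
        · rcases hy with rfl | hy
          · exact absurd hxy (lt_irrefl _)
          · exact absurd hxy (hb y hy).not_gt
        · exact hx
      have hyb : y ≤ b := by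
        rcases hy with rfl | hy
        · exact le_rfl
        · exact (hb y hy).le
      rw [Finset.filter_insert, if_neg fun h => absurd h.2 hyb.not_gt] at hd
      rcases hy with rfl | hy
      · refine Finset.mem_union_right _ (Finset.mem_image.2 ⟨x, Finset.mem_filter.2 ⟨hxJ, ?_⟩, rfl⟩)
        exact hd.trans (Finset.card_le_card
          (Finset.monotone_filter_right _ fun a _ h => h.1))
      · exact Finset.mem_union_left _
          (Finset.mem_filter.2 ⟨Finset.mem_product.2 ⟨hxJ, hy⟩, hxy, hd⟩)
    have h1 := (Finset.card_le_card hsub).trans (Finset.card_union_le _ _)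
    have h2 := h1.trans (Nat.add_le_add ih
      (Finset.card_image_le.trans (card_filter_le_card_above_le J d)))
    refine h2.trans ?_
    rw [Finset.card_insert_of_notMem hbJ]
    rcases le_total d J.card with h | h
    · rw [Nat.sub_add_comm h, Nat.choose_succ_succ' _ 1, Nat.choose_one_right, add_comm]
    · simp [Nat.sub_eq_zero_of_le h]

/-- If `3 ∑ z ≤ M · #s` and each `z e ≤ M`, then the quantities `r e ≤ (z e + 2).choose 2`
average to at most `(M + 2)² / 4`. -/
lemma four_mul_sum_le_of_average {ι : Type*} (s : Finset ι) (z r : ι → ℕ) (M : ℕ)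
    (hz : ∀ e ∈ s, z e ≤ M) (hr : ∀ e ∈ s, r e ≤ (z e + 2).choose 2)
    (hsum : 3 * ∑ e ∈ s, z e ≤ M * s.card) :
    4 * ∑ e ∈ s, r e ≤ (M + 2) ^ 2 * s.card := by
  have hpt : ∀ e ∈ s, 4 * r e ≤ 2 * (M + 3) * z e + 4 := by
    intro e he
    have h1 : (z e + 2).choose 2 * 2 = (z e + 2) * (z e + 1) := by
      rw [Nat.choose_two_right]
      exact Nat.div_mul_cancel (Nat.even_mul_pred_self (z e + 2)).two_dvd
    nlinarith [hz e he, hr e he, Nat.mul_le_mul_left (z e) (hz e he)]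
  have h := Finset.sum_le_sum hpt
  rw [← Finset.mul_sum, Finset.sum_add_distrib, ← Finset.mul_sum, Finset.sum_const,
    smul_eq_mul] at h
  nlinarith [Nat.mul_le_mul_left (M + 3) hsum, Nat.zero_le (M * s.card),
    Nat.zero_le (M ^ 2 * s.card)]

/-- Lemma 2.2 (relevant edge recursion): for a graph on `n` vertices oriented by a
linear order and `c ≥ 2`,
`Σ_{e ∈ RE(G,c)} |RE(G[C(e)], c-2)| ≤ Σ_{e ∈ RE(G,c)} |RP(C(e), c-2)|` and
`Σ_{e ∈ RE(G,c)} |RP(C(e), c-2)| ≤ ((n-c)/2)² |RE(G,c)|` (stated multiplied by 4). -/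
theorem stmt_4 {V : Type*} [Fintype V] [LinearOrder V] (G : SimpleGraph V)
    (c : ℕ) (hc : 2 ≤ c) :
    let between : Finset V → V → V → Finset V := fun I a b =>
      I.filter fun w => a < w ∧ w < b
    let RP : Finset V → ℕ → Finset (V × V) := fun I d =>
      (I ×ˢ I).filter fun p => p.1 < p.2 ∧ d ≤ (between I p.1 p.2).card
    let RE : Finset V → ℕ → Finset (V × V) := fun I d =>
      (RP I d).filter fun p => G.Adj p.1 p.2
    let C : V × V → Finset V := fun p =>
      Finset.univ.filter fun w => p.1 < w ∧ w < p.2 ∧ G.Adj p.1 w ∧ G.Adj p.2 w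
    (∑ e ∈ RE Finset.univ c, (RE (C e) (c - 2)).card ≤
        ∑ e ∈ RE Finset.univ c, (RP (C e) (c - 2)).card) ∧
      4 * ∑ e ∈ RE Finset.univ c, (RP (C e) (c - 2)).card ≤
        (Fintype.card V - c) ^ 2 * (RE Finset.univ c).card := by
  intro between RP RE C
  refine ⟨Finset.sum_le_sum fun e _ => Finset.card_le_card (Finset.filter_subset _ _), ?_⟩
  have memRE : ∀ u v : V, (u, v) ∈ RE Finset.univ c ↔
      (u < v ∧ c ≤ (between Finset.univ u v).card) ∧ G.Adj u v := by
    intro u v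
    simp [RE, RP]
  have memC : ∀ u v w : V, w ∈ C (u, v) ↔ u < w ∧ w < v ∧ G.Adj u w ∧ G.Adj v w := by
    intro u v w
    simp [C]
  let z : V × V → ℕ := fun e => (C e).card - c
  let above : V × V → Finset V := fun f => Finset.univ.filter fun v => f.2 < v
  let below : V × V → Finset V := fun f => Finset.univ.filter fun v => v < f.1
  have hout : ∀ f ∈ RE Finset.univ c,
      (above f).card + (below f).card + z f + (c + 2) ≤ Fintype.card V := by
    rintro ⟨u, v⟩ hf
    obtain ⟨⟨huv, hgap⟩, -⟩ := (memRE u v).1 hf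
    have hC : (C (u, v)).card ≤ (between Finset.univ u v).card := by
      refine Finset.card_le_card fun w hw => ?_
      rw [memC] at hw
      simp [between, hw.1, hw.2.1]
    have hd1 : Disjoint (above (u, v)) (below (u, v)) := by
      refine Finset.disjoint_left.2 fun x hx hx' => ?_
      simp only [above, below, Finset.mem_filter] at hx hx'
      exact lt_asymm huv (hx.2.trans hx'.2)
    have hd2 : Disjoint (above (u, v) ∪ below (u, v)) (between Finset.univ u v) := by
      refine Finset.disjoint_left.2 fun x hx hx' => ?_
      simp only [above, below, between, Finset.mem_union, Finset.mem_filter] at hx hx'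
      rcases hx with hx | hx
      · exact lt_asymm hx.2 hx'.2.2
      · exact lt_asymm hx.2 hx'.2.1
    have hd3 : Disjoint ((above (u, v) ∪ below (u, v)) ∪ between Finset.univ u v) {u, v} := by
      refine Finset.disjoint_right.2 fun x hx hx' => ?_
      simp only [Finset.mem_insert, Finset.mem_singleton] at hx
      simp only [above, below, between, Finset.mem_union, Finset.mem_filter] at hx'
      rcases hx with rfl | rfl
      · rcases hx' with (h | h) | h
        · exact lt_asymm huv h.2
        · exact lt_irrefl _ h.2
        · exact lt_irrefl _ h.2.1
      · rcases hx' with (h | h) | h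
        · exact lt_irrefl _ h.2
        · exact lt_asymm huv h.2
        · exact lt_irrefl _ h.2.2
    have h := Finset.card_le_univ
      (((above (u, v) ∪ below (u, v)) ∪ between Finset.univ u v) ∪ {u, v})
    rw [Finset.card_union_of_disjoint hd3, Finset.card_union_of_disjoint hd2,
      Finset.card_union_of_disjoint hd1, Finset.card_pair huv.ne] at h
    simp only [z]
    omega
  have hA : ∑ e ∈ RE Finset.univ c, z e ≤ ∑ f ∈ RE Finset.univ c, (above f).card := by
    have hz : ∀ e ∈ RE Finset.univ c,
        z e ≤ ((C e).filter fun w => (e.1, w) ∈ RE Finset.univ c).card := by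
      rintro ⟨u, v⟩ -
      refine Nat.sub_le_of_le_add ((card_le_card_filter_le_card_below (C (u, v)) c).trans
        (Nat.add_le_add_right (Finset.card_le_card fun w hw => ?_) c))
      rw [Finset.mem_filter] at hw ⊢
      have hw' := (memC u v w).1 hw.1
      refine ⟨hw.1, (memRE u w).2 ⟨⟨hw'.1, hw.2.trans (Finset.card_le_card fun a ha => ?_)⟩,
        hw'.2.2.1⟩⟩
      rw [Finset.mem_filter, memC] at ha
      simp [between, ha.1.1, ha.2]
    refine (Finset.sum_le_sum hz).trans ?_
    rw [← Finset.card_sigma, ← Finset.card_sigma]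
    refine Finset.card_le_card_of_injOn (fun x => ⟨(x.1.1, x.2), x.1.2⟩) ?_ ?_
    · rintro ⟨⟨u, v⟩, w⟩ hx
      simp only [Finset.mem_coe, Finset.mem_sigma, Finset.mem_filter, memC] at hx ⊢
      exact ⟨hx.2.2, by simp [above, hx.2.1.2.1]⟩
    · rintro ⟨⟨u, v⟩, w⟩ - ⟨⟨u', v'⟩, w'⟩ - h
      simp_all
  have hB : ∑ e ∈ RE Finset.univ c, z e ≤ ∑ f ∈ RE Finset.univ c, (below f).card := by
    have hz : ∀ e ∈ RE Finset.univ c,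
        z e ≤ ((C e).filter fun w => (w, e.2) ∈ RE Finset.univ c).card := by
      rintro ⟨u, v⟩ -
      refine Nat.sub_le_of_le_add ((card_le_card_filter_le_card_above (C (u, v)) c).trans
        (Nat.add_le_add_right (Finset.card_le_card fun w hw => ?_) c))
      rw [Finset.mem_filter] at hw ⊢
      have hw' := (memC u v w).1 hw.1
      refine ⟨hw.1, (memRE w v).2 ⟨⟨hw'.2.1, hw.2.trans (Finset.card_le_card fun a ha => ?_)⟩,
        hw'.2.2.2.symm⟩⟩
      rw [Finset.mem_filter, memC] at ha
      simp [between, ha.1.2.1, ha.2]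
    refine (Finset.sum_le_sum hz).trans ?_
    rw [← Finset.card_sigma, ← Finset.card_sigma]
    refine Finset.card_le_card_of_injOn (fun x => ⟨(x.2, x.1.2), x.1.1⟩) ?_ ?_
    · rintro ⟨⟨u, v⟩, w⟩ hx
      simp only [Finset.mem_coe, Finset.mem_sigma, Finset.mem_filter, memC] at hx ⊢
      exact ⟨hx.2.2, by simp [below, hx.2.1.1]⟩
    · rintro ⟨⟨u, v⟩, w⟩ - ⟨⟨u', v'⟩, w'⟩ - h
      simp_all
  rcases (RE Finset.univ c).eq_empty_or_nonempty with hempty | ⟨e₀, he₀⟩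
  · simp [hempty]
  obtain ⟨M, hM⟩ : ∃ M, Fintype.card V = M + (c + 2) :=
    ⟨_, (Nat.sub_add_cancel (le_of_add_le_right (hout e₀ he₀))).symm⟩
  rw [hM, show M + (c + 2) - c = M + 2 by omega]
  refine four_mul_sum_le_of_average _ z _ M (fun e he => ?_) (fun e _ => ?_) ?_
  · have := hout e he
    omega
  · exact (card_relevant_pairs_le (C e) (c - 2)).trans
      (Nat.choose_le_choose 2 (by simp only [z]; omega))
  · have h : ∑ f ∈ RE Finset.univ c, ((above f).card + (below f).card + z f) ≤
        ∑ _f ∈ RE Finset.univ c, M :=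
      Finset.sum_le_sum fun f hf => by
        have := hout f hf
        omega
    rw [Finset.sum_add_distrib, Finset.sum_add_distrib, Finset.sum_const, smul_eq_mul,
      mul_comm] at h
    omega
end

section
/- Let G be a finite simple graph with at least one edge that is s-degenerate with s ≥ 1. Then G is (s−1)-community degenerate; in particular, the community degeneracy of G is strictly smaller than its degeneracy. -/
/-- A subgraph `H` with an edge of an `s`-degenerate graph `G` has an edge with at most `s - 1`
common neighbors: take any edge at a vertex of small degree among the non-isolated vertices. -/
theorem exists_adj_ncard_commonNeighbors_le {V : Type*} [Fintype V] {G H : SimpleGraph V} {s : ℕ}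
    (hdeg : ∀ W : Finset V, W.Nonempty →
      ∃ v ∈ W, {w | w ∈ W ∧ G.Adj v w}.ncard ≤ s)
    (hle : H ≤ G) (hedge : ∃ u v, H.Adj u v) :
    ∃ u v, H.Adj u v ∧ {w | H.Adj u w ∧ H.Adj v w}.ncard ≤ s - 1 := by
  classical
  obtain ⟨a, b, hab⟩ := hedge
  obtain ⟨v, hvW, hv⟩ := hdeg (Finset.univ.filter fun x => ∃ y, H.Adj x y)
    ⟨a, by simpa using ⟨b, hab⟩⟩
  obtain ⟨w, hvw⟩ : ∃ y, H.Adj v y := by simpa using hvW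
  refine ⟨v, w, hvw, ?_⟩
  have hw : w ∈ {x | x ∈ Finset.univ.filter (fun x => ∃ y, H.Adj x y) ∧ G.Adj v x} :=
    ⟨by simpa using ⟨v, hvw.symm⟩, hle hvw⟩
  refine le_trans (Set.ncard_le_ncard ?_ (Set.toFinite _))
    ((Set.ncard_sdiff_singleton_of_mem hw).le.trans (Nat.sub_le_sub_right hv 1))
  rintro x ⟨hvx, hwx⟩
  exact ⟨⟨by simpa using ⟨v, hvx.symm⟩, hle hvx⟩, hwx.ne'⟩

/-- A finite graph with an edge is not `0`-degenerate. -/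
theorem pos_of_degenerate_of_adj {V : Type*} [Fintype V] {G : SimpleGraph V} {t : ℕ}
    (hdeg : ∀ W : Finset V, W.Nonempty →
      ∃ v ∈ W, {w | w ∈ W ∧ G.Adj v w}.ncard ≤ t)
    {a b : V} (hab : G.Adj a b) : 0 < t := by
  classical
  obtain ⟨v, hvW, hv⟩ := hdeg {a, b} ⟨a, by simp⟩
  refine lt_of_lt_of_le ((Set.ncard_pos (Set.toFinite _)).2 ?_) hv
  obtain rfl | rfl : v = a ∨ v = b := by simpa using hvW
  · exact ⟨b, by simp, hab⟩
  · exact ⟨a, by simp, hab.symm⟩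


/-- An `s`-degenerate finite simple graph with at least one edge (and `s ≥ 1`) is
`(s-1)`-community degenerate; in particular, its community degeneracy is strictly
smaller than its degeneracy. -/
theorem stmt_8 {V : Type*} [Fintype V] (G : SimpleGraph V) (s : ℕ) (hs : 1 ≤ s)
    (hedge : ∃ u v, G.Adj u v)
    (hdeg : ∀ W : Finset V, W.Nonempty →
      ∃ v ∈ W, {w | w ∈ W ∧ G.Adj v w}.ncard ≤ s) :
    (∀ H : SimpleGraph V, H ≤ G → (∃ u v, H.Adj u v) →
      ∃ u v, H.Adj u v ∧ {w | H.Adj u w ∧ H.Adj v w}.ncard ≤ s - 1) ∧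
    sInf {σ : ℕ | ∀ H : SimpleGraph V, H ≤ G → (∃ u v, H.Adj u v) →
        ∃ u v, H.Adj u v ∧ {w | H.Adj u w ∧ H.Adj v w}.ncard ≤ σ} <
      sInf {t : ℕ | ∀ W : Finset V, W.Nonempty →
        ∃ v ∈ W, {w | w ∈ W ∧ G.Adj v w}.ncard ≤ t} := by
  refine ⟨fun H hle hH => exists_adj_ncard_commonNeighbors_le hdeg hle hH, ?_⟩
  obtain ⟨a, b, hab⟩ := hedge
  have hmin := Nat.sInf_mem (s := {t : ℕ | ∀ W : Finset V, W.Nonempty →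
    ∃ v ∈ W, {w | w ∈ W ∧ G.Adj v w}.ncard ≤ t}) ⟨s, hdeg⟩
  exact lt_of_le_of_lt
    (Nat.sInf_le fun H hle hH => exists_adj_ncard_commonNeighbors_le hmin hle hH)
    (Nat.sub_lt (pos_of_degenerate_of_adj hmin hab) one_pos)
end

section
/- A finite simple graph with m edges and community degeneracy σ contains at most σ·m triangles. -/
open scoped Classical

/-- Every triangle either avoids the edge `uv` or consists of `uv` and a common neighbor. -/
theorem card_cliqueFinset_three_le_deleteEdges {V : Type*} [Fintype V] (G : SimpleGraph V)
    (u v : V) :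
    (G.cliqueFinset 3).card ≤ ((G.deleteEdges {s(u, v)}).cliqueFinset 3).card +
      {w | G.Adj u w ∧ G.Adj v w}.ncard := by
  have hsub : G.cliqueFinset 3 ⊆ (G.deleteEdges {s(u, v)}).cliqueFinset 3 ∪
      {w | G.Adj u w ∧ G.Adj v w}.toFinset.image (fun w => ({u, v, w} : Finset V)) := by
    intro t ht
    rw [SimpleGraph.mem_cliqueFinset_iff, SimpleGraph.is3Clique_iff] at ht
    obtain ⟨a, b, c, hab, hac, hbc, rfl⟩ := ht
    by_cases h : (G.deleteEdges {s(u, v)}).IsNClique 3 {a, b, c}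
    · exact Finset.mem_union_left _ (SimpleGraph.mem_cliqueFinset_iff.2 h)
    · rw [SimpleGraph.is3Clique_triple_iff] at h
      simp only [SimpleGraph.deleteEdges_adj, Set.mem_singleton_iff, hab, hac, hbc, true_and] at h
      refine Finset.mem_union_right _ (Finset.mem_image.2 ?_)
      simp only [Set.mem_toFinset, Set.mem_ofPred_eq]
      have hcases : s(a, b) = s(u, v) ∨ s(a, c) = s(u, v) ∨ s(b, c) = s(u, v) := by tauto
      simp only [Sym2.eq_iff] at hcases
      rcases hcases with (⟨rfl, rfl⟩ | ⟨rfl, rfl⟩) | (⟨rfl, rfl⟩ | ⟨rfl, rfl⟩) |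
        (⟨rfl, rfl⟩ | ⟨rfl, rfl⟩)
      · exact ⟨c, ⟨hac, hbc⟩, rfl⟩
      · exact ⟨c, ⟨hbc, hac⟩, by grind⟩
      · exact ⟨b, ⟨hab, hbc.symm⟩, by grind⟩
      · exact ⟨b, ⟨hbc.symm, hab⟩, by grind⟩
      · exact ⟨a, ⟨hab.symm, hac.symm⟩, by grind⟩
      · exact ⟨a, ⟨hac.symm, hab.symm⟩, by grind⟩
  rw [Set.ncard_eq_toFinset_card']
  exact (Finset.card_le_card hsub).trans <| (Finset.card_union_le _ _).trans <|
    Nat.add_le_add_left Finset.card_image_le _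

/-- A finite simple graph with `m` edges and community degeneracy `σ` has at most
`σ * m` triangles. -/
theorem stmt_10 {V : Type*} [Fintype V] (G : SimpleGraph V) (σ : ℕ)
    (hcd : ∀ H : SimpleGraph V, H ≤ G → (∃ u v, H.Adj u v) →
      ∃ u v, H.Adj u v ∧ {w | H.Adj u w ∧ H.Adj v w}.ncard ≤ σ) :
    (G.cliqueFinset 3).card ≤ σ * G.edgeFinset.card := by
  induction hm : G.edgeFinset.card generalizing G with
  | zero =>
    have hG : G = ⊥ := by simpa using hm
    subst hG
    simp [SimpleGraph.cliqueFinset_eq_empty_iff, SimpleGraph.cliqueFree_bot]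
  | succ m ih =>
    obtain ⟨e, he⟩ := Finset.card_pos.1 (by omega : 0 < G.edgeFinset.card)
    obtain ⟨u, v, huv, hle⟩ := hcd G le_rfl <| by
      induction e with
      | h a b => exact ⟨a, b, by simpa using he⟩
    have hdel : (G.deleteEdges {s(u, v)}).edgeFinset = G.edgeFinset.erase s(u, v) := by
      ext e
      simp [and_comm]
    have hcard : (G.deleteEdges {s(u, v)}).edgeFinset.card = m := by
      rw [hdel, Finset.card_erase_of_mem (by simpa using huv), hm, Nat.add_sub_cancel]
    have hrec := ih (G.deleteEdges {s(u, v)})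
      (fun H hH => hcd H (hH.trans (G.deleteEdges_le _))) (by convert hcard)
    calc (G.cliqueFinset 3).card
        ≤ ((G.deleteEdges {s(u, v)}).cliqueFinset 3).card +
            {w | G.Adj u w ∧ G.Adj v w}.ncard := card_cliqueFinset_three_le_deleteEdges G u v
      _ ≤ σ * m + σ := Nat.add_le_add (by convert hrec) hle
      _ = σ * (m + 1) := (Nat.mul_succ σ m).symm
end
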